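/- Let F be the centered Gaussian process with covariance E[F(s)F(t)] = (2π)^{-1/2}(√(t+s) − √|t−s|). For n ≥ 1 let ΔF_j = F(j/n) − F((j−1)/n) and σ_j² = E[ΔF_j²]. Then for all 0 ≤ s < t, lim_{n→∞} E | ∑_{j=⌊ns⌋+1}^{⌊nt⌋} ( ΔF_j² − σ_j² ) |² = κ² (t − s), where κ² = 4/π + (2/π) ∑_{i=1}^∞ γ_i². (This is the variance limit underlying the convergence of the centered quadratic variation of F to κ times a Brownian motion independent of F.) -/

import Mathlib

open MeasureTheory ProbabilityTheory Filter

/-- The covariance function `K(s,t) = (2π)^{-1/2}(√(t+s) − √|t−s|)`. -/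
noncomputable def covK (s t : ℝ) : ℝ :=
  (Real.sqrt (2 * Real.pi))⁻¹ * (Real.sqrt (t + s) - Real.sqrt |t - s|)

/-- `F` is the centered Gaussian process with covariance `covK`, on a probability
space `(Ω, P)`: every finite linear combination of values of `F` at nonnegative
times is centered Gaussian with the prescribed variance. -/
def IsHeatGaussian {Ω : Type*} [MeasurableSpace Ω] (P : Measure Ω)
    (F : ℝ → Ω → ℝ) : Prop :=
  IsProbabilityMeasure P ∧ (∀ t : ℝ, Measurable (F t)) ∧
  ∀ (m : ℕ) (ts : Fin m → ℝ) (c : Fin m → ℝ), (∀ i, 0 ≤ ts i) →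
    Measure.map (fun ω => ∑ i, c i * F (ts i) ω) P =
      gaussianReal 0 (Real.toNNReal (∑ i, ∑ j, c i * c j * covK (ts i) (ts j)))

/-- `γ_k = 2√k − √(k−1) − √(k+1)`. -/
noncomputable def gam (k : ℕ) : ℝ :=
  2 * Real.sqrt k - Real.sqrt ((k : ℝ) - 1) - Real.sqrt ((k : ℝ) + 1)

open scoped NNReal in
/-- The fourth moment of a centered real Gaussian distribution. -/
lemma integral_pow_four_gaussianReal (v : ℝ≥0) :
    ∫ x, x ^ 4 ∂gaussianReal 0 v = 3 * (v : ℝ) ^ 2 := by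
  have h := iteratedDeriv_mgf_zero (X := id) (μ := gaussianReal 0 v)
    (by simp [integrableExpSet_id_gaussianReal]) 4
  rw [mgf_id_gaussianReal] at h
  have key : ∀ (p p' : ℝ → ℝ), (∀ t, HasDerivAt p (p' t) t) →
      deriv (fun t => p t * Real.exp (0 * t + v * t ^ 2 / 2)) =
        fun t => (p' t + v * t * p t) * Real.exp (0 * t + v * t ^ 2 / 2) := by
    intro p p' hp
    funext t
    have h1 : HasDerivAt (fun t : ℝ => 0 * t + v * t ^ 2 / 2) (v * t) t := by
      convert! ((hasDerivAt_id t).const_mul 0).add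
        ((((hasDerivAt_id t).pow 2).const_mul (v : ℝ)).div_const 2) using 1
      simp
      ring
    exact ((hp t).mul h1.exp).deriv.trans (by ring)
  have e1 : deriv (fun t => Real.exp (0 * t + v * t ^ 2 / 2)) =
      fun t => (v * t) * Real.exp (0 * t + v * t ^ 2 / 2) := by
    simpa using key (fun _ => 1) (fun _ => 0) fun t => hasDerivAt_const t 1
  have e2 := key (fun t => v * t) (fun _ => v) fun t => by
    simpa using (hasDerivAt_id t).const_mul (v : ℝ)
  have e3 := key (fun t => v + v * t * (v * t)) (fun t => 2 * v ^ 2 * t) fun t => by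
    have h := (hasDerivAt_id t).const_mul (v : ℝ)
    convert! (h.mul h).const_add (v : ℝ) using 1
    simp
    ring
  have e4 := key (fun t => 2 * v ^ 2 * t + v * t * (v + v * t * (v * t)))
    (fun t => 3 * v ^ 2 + 3 * v ^ 3 * t ^ 2) fun t => by
    have h := ((hasDerivAt_id t).const_mul (3 * (v : ℝ) ^ 2)).add
      (((hasDerivAt_id t).pow 3).const_mul ((v : ℝ) ^ 3))
    convert! h using 1
    · funext x
      simp
      ring
    · simp
      ring
  simp only [iteratedDeriv_succ, iteratedDeriv_zero] at h
  rw [e1, e2, e3, e4] at h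
  simpa using h.symm

section GaussianLaw

variable {Ω : Type*} [MeasurableSpace Ω] {P : Measure Ω} {X Y : Ω → ℝ}

open scoped NNReal

lemma integrable_pow_of_map_eq_gaussianReal (hX : Measurable X) {v : ℝ≥0}
    (h : P.map X = gaussianReal 0 v) (k : ℕ) : Integrable (fun ω => X ω ^ k) P := by
  have h1 : Integrable (fun x : ℝ => x ^ k) (P.map X) := by
    rw [h]
    rcases Nat.eq_zero_or_pos k with rfl | hk
    · simp
    have := (memLp_id_gaussianReal (μ := 0) (v := v) (k : ℝ≥0))
    refine (this.integrable_norm_pow (by simpa using hk.ne')).mono'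
      (continuous_pow k).aestronglyMeasurable ?_
    simp
  exact (integrable_map_measure (continuous_pow k).aestronglyMeasurable hX.aemeasurable).1 h1

lemma integral_sq_of_map_eq_gaussianReal (hX : Measurable X) {v : ℝ≥0}
    (h : P.map X = gaussianReal 0 v) : ∫ ω, X ω ^ 2 ∂P = v := by
  have h1 : ∫ x, x ^ 2 ∂(P.map X) = ∫ ω, X ω ^ 2 ∂P :=
    integral_map hX.aemeasurable (by fun_prop)
  rw [← h1, h, ← variance_fun_id_gaussianReal (μ := 0) (v := v), variance_eq_integral (by fun_prop)]
  simp

lemma integral_pow_four_of_map_eq_gaussianReal (hX : Measurable X) {v : ℝ≥0}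
    (h : P.map X = gaussianReal 0 v) : ∫ ω, X ω ^ 4 ∂P = 3 * (∫ ω, X ω ^ 2 ∂P) ^ 2 := by
  have h1 : ∫ x, x ^ 4 ∂(P.map X) = ∫ ω, X ω ^ 4 ∂P :=
    integral_map hX.aemeasurable (by fun_prop)
  rw [← h1, h, integral_pow_four_gaussianReal, integral_sq_of_map_eq_gaussianReal hX h]

lemma integrable_mul_of_jointly_gaussian (hX : Measurable X) (hY : Measurable Y)
    (h : ∀ a b : ℝ, ∃ v : ℝ≥0, P.map (fun ω => a * X ω + b * Y ω) = gaussianReal 0 v) :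
    Integrable (fun ω => X ω * Y ω) P := by
  obtain ⟨v, hv⟩ := h 1 1
  obtain ⟨w, hw⟩ := h 1 (-1)
  have i1 := integrable_pow_of_map_eq_gaussianReal (by fun_prop) hv 2
  have i2 := integrable_pow_of_map_eq_gaussianReal (by fun_prop) hw 2
  refine ((i1.sub i2).div_const 4).congr (ae_of_all _ fun ω => ?_)
  simp only [Pi.sub_apply]
  ring

/-- Isserlis' formula for the centered squares of two jointly Gaussian variables. -/
lemma integral_centered_sq_mul_centered_sq [IsProbabilityMeasure P]
    (hX : Measurable X) (hY : Measurable Y)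
    (h : ∀ a b : ℝ, ∃ v : ℝ≥0, P.map (fun ω => a * X ω + b * Y ω) = gaussianReal 0 v) :
    Integrable (fun ω => (X ω ^ 2 - ∫ ω', X ω' ^ 2 ∂P) * (Y ω ^ 2 - ∫ ω', Y ω' ^ 2 ∂P)) P ∧
    ∫ ω, (X ω ^ 2 - ∫ ω', X ω' ^ 2 ∂P) * (Y ω ^ 2 - ∫ ω', Y ω' ^ 2 ∂P) ∂P =
      2 * (∫ ω, X ω * Y ω ∂P) ^ 2 := by
  have hXY := integrable_mul_of_jointly_gaussian hX hY h
  obtain ⟨v, hv⟩ := h 1 1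
  obtain ⟨w, hw⟩ := h 1 (-1)
  obtain ⟨x, hx⟩ := h 1 0
  obtain ⟨y, hy⟩ := h 0 1
  simp only [one_mul, zero_mul, add_zero, zero_add, neg_mul, ← sub_eq_add_neg] at hv hw hx hy
  have hS : Measurable fun ω => X ω + Y ω := by fun_prop
  have hD : Measurable fun ω => X ω - Y ω := by fun_prop
  have iS := integrable_pow_of_map_eq_gaussianReal hS hv 4
  have iD := integrable_pow_of_map_eq_gaussianReal hD hw 4
  have iX := integrable_pow_of_map_eq_gaussianReal hX hx
  have iY := integrable_pow_of_map_eq_gaussianReal hY hy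
  have mS := integral_pow_four_of_map_eq_gaussianReal hS hv
  have mD := integral_pow_four_of_map_eq_gaussianReal hD hw
  have mX := integral_pow_four_of_map_eq_gaussianReal hX hx
  have mY := integral_pow_four_of_map_eq_gaussianReal hY hy
  have iA : Integrable (fun ω => X ω ^ 2 + Y ω ^ 2) P := (iX 2).add (iY 2)
  have eS : ∫ ω, (X ω + Y ω) ^ 2 ∂P =
      ∫ ω, X ω ^ 2 ∂P + ∫ ω, Y ω ^ 2 ∂P + 2 * ∫ ω, X ω * Y ω ∂P := by
    rw [← integral_const_mul, ← integral_add (iX 2) (iY 2),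
      ← integral_add iA (hXY.const_mul 2)]
    exact integral_congr_ae (ae_of_all _ fun ω => by ring)
  have eD : ∫ ω, (X ω - Y ω) ^ 2 ∂P =
      ∫ ω, X ω ^ 2 ∂P + ∫ ω, Y ω ^ 2 ∂P - 2 * ∫ ω, X ω * Y ω ∂P := by
    rw [← integral_const_mul, ← integral_add (iX 2) (iY 2),
      ← integral_sub iA (hXY.const_mul 2)]
    exact integral_congr_ae (ae_of_all _ fun ω => by ring)
  have ptw : ∀ ω, X ω ^ 2 * Y ω ^ 2 =
      ((X ω + Y ω) ^ 4 + (X ω - Y ω) ^ 4 - 2 * (X ω ^ 4 + Y ω ^ 4)) / 12 := fun ω => by ring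
  have iSD : Integrable (fun ω => (X ω + Y ω) ^ 4 + (X ω - Y ω) ^ 4) P := iS.add iD
  have iXY4 : Integrable (fun ω => 2 * (X ω ^ 4 + Y ω ^ 4)) P :=
    ((iX 4).add (iY 4)).const_mul 2
  have iQ : Integrable (fun ω => X ω ^ 2 * Y ω ^ 2) P := by
    simp only [ptw]
    exact (iSD.sub iXY4).div_const 12
  have eQ : ∫ ω, X ω ^ 2 * Y ω ^ 2 ∂P =
      (∫ ω, X ω ^ 2 ∂P) * (∫ ω, Y ω ^ 2 ∂P) + 2 * (∫ ω, X ω * Y ω ∂P) ^ 2 := by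
    simp only [ptw]
    rw [integral_div, integral_sub iSD iXY4, integral_add iS iD, integral_const_mul,
      integral_add (iX 4) (iY 4), mS, mD, mX, mY, eS, eD]
    ring
  set a := ∫ ω, X ω ^ 2 ∂P
  set b := ∫ ω, Y ω ^ 2 ∂P
  have ptw' : ∀ ω, (X ω ^ 2 - a) * (Y ω ^ 2 - b) =
      X ω ^ 2 * Y ω ^ 2 - (b * X ω ^ 2 + a * Y ω ^ 2) + a * b := fun ω => by ring
  have i1 : Integrable (fun ω => b * X ω ^ 2 + a * Y ω ^ 2) P :=
    ((iX 2).const_mul b).add ((iY 2).const_mul a)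
  have i2 : Integrable (fun ω => X ω ^ 2 * Y ω ^ 2 - (b * X ω ^ 2 + a * Y ω ^ 2)) P := iQ.sub i1
  simp only [ptw']
  refine ⟨i2.add (integrable_const _), ?_⟩
  rw [integral_add i2 (integrable_const _), integral_sub iQ i1,
    integral_add ((iX 2).const_mul b) ((iY 2).const_mul a), integral_const_mul,
    integral_const_mul, eQ]
  simp
  ring

end GaussianLaw

section SqrtIncrements

/-- First differences of the square root. -/
noncomputable def sqrtStep (k : ℕ) : ℝ := √((k : ℝ) + 1) - √k

/-- Second differences of `x ↦ √|x|`. -/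
noncomputable def absSqrtDiff (x : ℝ) : ℝ := √|x - 1| + √|x + 1| - 2 * √|x|

lemma sqrtStep_nonneg (k : ℕ) : 0 ≤ sqrtStep k :=
  sub_nonneg.2 (Real.sqrt_le_sqrt (by linarith))

lemma gam_succ (k : ℕ) : gam (k + 1) = sqrtStep k - sqrtStep (k + 1) := by
  simp only [gam, sqrtStep]
  push_cast
  ring_nf

lemma gam_succ_nonneg (k : ℕ) : 0 ≤ gam (k + 1) := by
  have h0 : (0 : ℝ) ≤ k := k.cast_nonneg
  have h : √(k : ℝ) + √((k : ℝ) + 1 + 1) ≤ 2 * √((k : ℝ) + 1) := by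
    refine abs_le_of_sq_le_sq' ?_ (by positivity) |>.2
    have a := Real.sq_sqrt h0
    have b := Real.sq_sqrt (show 0 ≤ (k : ℝ) + 1 + 1 by positivity)
    have c := Real.sq_sqrt (show 0 ≤ (k : ℝ) + 1 by positivity)
    nlinarith [sq_nonneg (√(k : ℝ) - √((k : ℝ) + 1 + 1))]
  rw [gam_succ, sqrtStep, sqrtStep]
  push_cast
  linarith

lemma sqrtStep_antitone : Antitone sqrtStep :=
  antitone_nat_of_succ_le fun k => by linarith [gam_succ_nonneg k, gam_succ k]

lemma sqrtStep_le_one (k : ℕ) : sqrtStep k ≤ 1 :=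
  (sqrtStep_antitone k.zero_le).trans (by simp [sqrtStep])

lemma gam_succ_le_one (k : ℕ) : gam (k + 1) ≤ 1 := by
  linarith [gam_succ k, sqrtStep_le_one k, sqrtStep_nonneg (k + 1)]

lemma sum_gam_le (m N : ℕ) : ∑ q ∈ Finset.range N, gam (m + q + 1) ≤ sqrtStep m := by
  have h := Finset.sum_range_sub' (fun q => sqrtStep (m + q)) N
  simp only [gam_succ, add_zero, ← add_assoc] at h ⊢
  linarith [sqrtStep_nonneg (m + N)]

lemma sum_sqrtStep (N : ℕ) : ∑ p ∈ Finset.range N, sqrtStep p = √N := by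
  have h := Finset.sum_range_sub (fun q : ℕ => √(q : ℝ)) N
  simpa [sqrtStep] using h

lemma sum_sum_gam_le (m N : ℕ) :
    ∑ p ∈ Finset.range N, ∑ q ∈ Finset.range N, gam (m + p + q + 1) ≤ √N := by
  rw [← sum_sqrtStep]
  exact Finset.sum_le_sum fun p _ =>
    (sum_gam_le _ _).trans (sqrtStep_antitone (Nat.le_add_left p m))

lemma summable_gam_sq : Summable fun i : ℕ => gam (i + 1) ^ 2 := by
  refine summable_of_sum_range_le (c := 1) (fun i => sq_nonneg _) fun N => ?_
  calc ∑ i ∈ Finset.range N, gam (i + 1) ^ 2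
      ≤ ∑ i ∈ Finset.range N, gam (0 + i + 1) := by
        refine Finset.sum_le_sum fun i _ => ?_
        rw [zero_add]
        nlinarith [gam_succ_nonneg i, gam_succ_le_one i]
    _ ≤ 1 := (sum_gam_le 0 N).trans (sqrtStep_le_one 0)

lemma absSqrtDiff_zero : absSqrtDiff 0 = 2 := by
  norm_num [absSqrtDiff]

lemma absSqrtDiff_neg (x : ℝ) : absSqrtDiff (-x) = absSqrtDiff x := by
  have h1 : |-x - 1| = |x + 1| := by rw [← abs_neg]; ring_nf
  have h2 : |-x + 1| = |x - 1| := by rw [← abs_neg]; ring_nf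
  rw [absSqrtDiff, absSqrtDiff, h1, h2, abs_neg]
  ring

lemma absSqrtDiff_succ (k : ℕ) : absSqrtDiff ((k : ℝ) + 1) = -gam (k + 1) := by
  have h0 : (0 : ℝ) ≤ k := k.cast_nonneg
  rw [absSqrtDiff, gam, add_sub_cancel_right, abs_of_nonneg h0, abs_of_nonneg (by positivity),
    abs_of_nonneg (by positivity)]
  push_cast
  rw [add_sub_cancel_right]
  ring

lemma abs_absSqrtDiff_natCast_le (k : ℕ) : |absSqrtDiff k| ≤ 2 := by
  rcases k with _ | k
  · simp [absSqrtDiff_zero]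
  · push_cast
    rw [absSqrtDiff_succ, abs_neg, abs_of_nonneg (gam_succ_nonneg k)]
    linarith [gam_succ_le_one k]

lemma abs_absSqrtDiff_sub_le (p q : ℕ) : |absSqrtDiff ((p : ℝ) - q)| ≤ 2 := by
  rcases le_total q p with h | h
  · rw [← Nat.cast_sub h]
    exact abs_absSqrtDiff_natCast_le _
  · rw [← absSqrtDiff_neg, neg_sub, ← Nat.cast_sub h]
    exact abs_absSqrtDiff_natCast_le _

lemma sum_absSqrtDiff_sq_succ (N : ℕ) :
    ∑ p ∈ Finset.range (N + 1), ∑ q ∈ Finset.range (N + 1), absSqrtDiff ((p : ℝ) - q) ^ 2 =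
      (∑ p ∈ Finset.range N, ∑ q ∈ Finset.range N, absSqrtDiff ((p : ℝ) - q) ^ 2) +
        (4 + 2 * ∑ i ∈ Finset.range N, gam (i + 1) ^ 2) := by
  have h1 : ∑ q ∈ Finset.range N, absSqrtDiff ((N : ℝ) - q) ^ 2 =
      ∑ i ∈ Finset.range N, gam (i + 1) ^ 2 := by
    rw [← Finset.sum_range_reflect]
    refine Finset.sum_congr rfl fun i hi => ?_
    have hi' := Finset.mem_range.1 hi
    rw [← neg_sq (gam _), ← absSqrtDiff_succ, show N - 1 - i = N - (i + 1) by omega,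
      Nat.cast_sub (by omega)]
    push_cast
    ring_nf
  have h2 : ∑ p ∈ Finset.range N, absSqrtDiff ((p : ℝ) - N) ^ 2 =
      ∑ i ∈ Finset.range N, gam (i + 1) ^ 2 := by
    rw [← h1]
    exact Finset.sum_congr rfl fun p _ => by rw [← absSqrtDiff_neg, neg_sub]
  simp only [Finset.sum_range_succ, Finset.sum_add_distrib]
  rw [h1, h2, sub_self, absSqrtDiff_zero]
  ring

lemma sum_absSqrtDiff_sq (N : ℕ) :
    ∑ p ∈ Finset.range N, ∑ q ∈ Finset.range N, absSqrtDiff ((p : ℝ) - q) ^ 2 =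
      ∑ M ∈ Finset.range N, (4 + 2 * ∑ i ∈ Finset.range M, gam (i + 1) ^ 2) := by
  induction N with
  | zero => simp
  | succ N ih => rw [sum_absSqrtDiff_sq_succ, ih, Finset.sum_range_succ _ N]

lemma tendsto_mean_absSqrtDiff_sq :
    Tendsto (fun N : ℕ => (N : ℝ)⁻¹ *
      ∑ p ∈ Finset.range N, ∑ q ∈ Finset.range N, absSqrtDiff ((p : ℝ) - q) ^ 2)
      atTop (nhds (4 + 2 * ∑' i : ℕ, gam (i + 1) ^ 2)) := by
  simp only [sum_absSqrtDiff_sq]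
  exact ((summable_gam_sq.hasSum.tendsto_sum_nat.const_mul 2).const_add 4).cesaro

lemma abs_sum_sq_sub_sum_absSqrtDiff_sq_le (m N : ℕ) :
    |∑ p ∈ Finset.range N, ∑ q ∈ Finset.range N,
        (absSqrtDiff ((p : ℝ) - q) - gam (m + p + q + 1)) ^ 2 -
      ∑ p ∈ Finset.range N, ∑ q ∈ Finset.range N, absSqrtDiff ((p : ℝ) - q) ^ 2| ≤
      5 * √N := by
  simp only [← Finset.sum_sub_distrib]
  calc _ ≤ ∑ p ∈ Finset.range N, ∑ q ∈ Finset.range N, 5 * gam (m + p + q + 1) := by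
        refine (Finset.abs_sum_le_sum_abs _ _).trans (Finset.sum_le_sum fun p _ => ?_)
        refine (Finset.abs_sum_le_sum_abs _ _).trans (Finset.sum_le_sum fun q _ => ?_)
        have h0 := gam_succ_nonneg (m + p + q)
        have h1 := gam_succ_le_one (m + p + q)
        have h2 := abs_le.1 (abs_absSqrtDiff_sub_le p q)
        rw [show ∀ d g : ℝ, (d - g) ^ 2 - d ^ 2 = (g - 2 * d) * g by intros; ring, abs_mul,
          abs_of_nonneg h0]
        refine mul_le_mul_of_nonneg_right (abs_le.2 ⟨?_, ?_⟩) h0 <;> linarith [h2.1, h2.2]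
    _ ≤ 5 * √N := by
        simp only [← Finset.mul_sum]
        linarith [sum_sum_gam_le m N]

end SqrtIncrements

section HeatGaussian

variable {Ω : Type*} [MeasurableSpace Ω] {P : Measure Ω} {F : ℝ → Ω → ℝ}

open scoped NNReal

lemma covK_comm (s t : ℝ) : covK s t = covK t s := by
  rw [covK, covK, add_comm, abs_sub_comm]

lemma covK_self_nonneg (t : ℝ) : 0 ≤ covK t t := by
  rw [covK, sub_self, abs_zero, Real.sqrt_zero, sub_zero]
  positivity

namespace IsHeatGaussian

lemma map_pair (hF : IsHeatGaussian P F) {s t : ℝ} (hs : 0 ≤ s) (ht : 0 ≤ t) (a b : ℝ) :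
    P.map (fun ω => a * F s ω + b * F t ω) = gaussianReal 0
      (a ^ 2 * covK s s + 2 * (a * b) * covK s t + b ^ 2 * covK t t).toNNReal := by
  have h := hF.2.2 2 ![s, t] ![a, b] (by simp [Fin.forall_fin_two, hs, ht])
  simp only [Fin.sum_univ_two, Matrix.cons_val_zero, Matrix.cons_val_one] at h
  rw [h, covK_comm t s]
  congr 2
  ring

lemma integrable_mul (hF : IsHeatGaussian P F) {s t : ℝ} (hs : 0 ≤ s) (ht : 0 ≤ t) :
    Integrable (fun ω => F s ω * F t ω) P :=
  integrable_mul_of_jointly_gaussian (hF.2.1 s) (hF.2.1 t) fun a b => ⟨_, hF.map_pair hs ht a b⟩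

lemma integral_mul (hF : IsHeatGaussian P F) {s t : ℝ} (hs : 0 ≤ s) (ht : 0 ≤ t) :
    ∫ ω, F s ω * F t ω ∂P = covK s t := by
  have hms := hF.2.1 s
  have hmt := hF.2.1 t
  have sq : ∀ a b : ℝ, ∫ ω, (a * F s ω + b * F t ω) ^ 2 ∂P =
      max (a ^ 2 * covK s s + 2 * (a * b) * covK s t + b ^ 2 * covK t t) 0 := fun a b => by
    rw [integral_sq_of_map_eq_gaussianReal (by fun_prop) (hF.map_pair hs ht a b),
      Real.coe_toNNReal']
  have expand : ∀ a b : ℝ, ∫ ω, (a * F s ω + b * F t ω) ^ 2 ∂P =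
      a ^ 2 * ∫ ω, F s ω * F s ω ∂P + 2 * (a * b) * ∫ ω, F s ω * F t ω ∂P +
        b ^ 2 * ∫ ω, F t ω * F t ω ∂P := fun a b => by
    have i1 := (hF.integrable_mul hs hs).const_mul (a ^ 2)
    have i2 := (hF.integrable_mul hs ht).const_mul (2 * (a * b))
    have i3 := (hF.integrable_mul ht ht).const_mul (b ^ 2)
    rw [← integral_const_mul, ← integral_const_mul, ← integral_const_mul, ← integral_add i1 i2,
      ← integral_add (by exact i1.add i2) i3]
    exact integral_congr_ae (ae_of_all _ fun ω => by ring)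
  have h10 := (expand 1 0).symm.trans (sq 1 0)
  have h01 := (expand 0 1).symm.trans (sq 0 1)
  have hp := (expand 1 1).symm.trans (sq 1 1)
  have hm := (expand 1 (-1)).symm.trans (sq 1 (-1))
  norm_num [covK_self_nonneg] at h10 h01 hp hm
  have hp' := le_max_left (covK s s + 2 * covK s t + covK t t) 0
  have hm' := le_max_left (covK s s + -(2 * covK s t) + covK t t) 0
  linarith

/-- The covariance of two increments. -/
lemma integral_incr_mul_incr (hF : IsHeatGaussian P F) {s s' t t' : ℝ} (hs : 0 ≤ s) (hs' : 0 ≤ s')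
    (ht : 0 ≤ t) (ht' : 0 ≤ t') :
    ∫ ω, (F s ω - F s' ω) * (F t ω - F t' ω) ∂P =
      covK s t - covK s t' - covK s' t + covK s' t' := by
  have i1 := hF.integrable_mul hs ht
  have i2 := hF.integrable_mul hs ht'
  have i3 := hF.integrable_mul hs' ht
  have i12 : Integrable (fun ω => F s ω * F t ω - F s ω * F t' ω) P := i1.sub i2
  rw [← hF.integral_mul hs ht, ← hF.integral_mul hs ht', ← hF.integral_mul hs' ht,
    ← hF.integral_mul hs' ht', ← integral_sub i1 i2, ← integral_sub i12 i3,
    ← integral_add (by exact i12.sub i3) (hF.integrable_mul hs' ht')]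
  exact integral_congr_ae (ae_of_all _ fun ω => by ring)

lemma exists_map_incr_eq_gaussianReal (hF : IsHeatGaussian P F) {s s' t t' : ℝ} (hs : 0 ≤ s)
    (hs' : 0 ≤ s') (ht : 0 ≤ t) (ht' : 0 ≤ t') (a b : ℝ) :
    ∃ v : ℝ≥0, P.map (fun ω => a * (F s ω - F s' ω) + b * (F t ω - F t' ω)) =
      gaussianReal 0 v := by
  have h := hF.2.2 4 ![s, s', t, t'] ![a, -a, b, -b] (by simp [Fin.forall_fin_succ, *])
  refine ⟨_, Eq.trans ?_ h⟩
  congr 1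
  funext ω
  simp [Fin.sum_univ_four]
  ring

/-- The second moment of a sum of centered squared increments. -/
lemma integral_sum_centered_sq_incr_sq (hF : IsHeatGaussian P F) {ι : Type*} (S : Finset ι)
    (u v : ι → ℝ) (hu : ∀ i ∈ S, 0 ≤ u i) (hv : ∀ i ∈ S, 0 ≤ v i) :
    ∫ ω, (∑ i ∈ S, ((F (u i) ω - F (v i) ω) ^ 2 -
        ∫ ω', (F (u i) ω' - F (v i) ω') ^ 2 ∂P)) ^ 2 ∂P =
      ∑ i ∈ S, ∑ j ∈ S,
        2 * (covK (u i) (u j) - covK (u i) (v j) - covK (v i) (u j) + covK (v i) (v j)) ^ 2 := by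
  have := hF.1
  have hm := hF.2.1
  have key := fun i hi j hj => integral_centered_sq_mul_centered_sq
    ((hm (u i)).sub (hm (v i))) ((hm (u j)).sub (hm (v j)))
    (hF.exists_map_incr_eq_gaussianReal (hu i hi) (hv i hi) (hu j hj) (hv j hj))
  simp only [Pi.sub_apply] at key
  simp only [sq (∑ i ∈ S, _), Finset.sum_mul_sum]
  rw [integral_finsetSum _ fun i hi => integrable_finsetSum _ fun j hj => (key i hi j hj).1]
  refine Finset.sum_congr rfl fun i hi => ?_
  rw [integral_finsetSum _ fun j hj => (key i hi j hj).1]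
  refine Finset.sum_congr rfl fun j hj => ?_
  rw [(key i hi j hj).2,
    hF.integral_incr_mul_incr (hu i hi) (hv i hi) (hu j hj) (hv j hj)]

end IsHeatGaussian

/-- The covariance of the increments over the intervals `[(a+p)/n, (a+p+1)/n]` and
`[(a+q)/n, (a+q+1)/n]`. -/
lemma covK_increments (a p q n : ℕ) :
    covK (((a + 1 + p : ℕ) : ℝ) / n) (((a + 1 + q : ℕ) : ℝ) / n) -
        covK (((a + 1 + p : ℕ) : ℝ) / n) ((((a + 1 + q : ℕ) : ℝ) - 1) / n) -
        covK ((((a + 1 + p : ℕ) : ℝ) - 1) / n) (((a + 1 + q : ℕ) : ℝ) / n) +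
        covK ((((a + 1 + p : ℕ) : ℝ) - 1) / n) ((((a + 1 + q : ℕ) : ℝ) - 1) / n) =
      (√(2 * Real.pi))⁻¹ * (√n)⁻¹ *
        (absSqrtDiff ((p : ℝ) - q) - gam (2 * a + p + q + 1)) := by
  have hn : (0 : ℝ) ≤ n := n.cast_nonneg
  have scale : ∀ x y : ℝ, covK (x / n) (y / n) =
      (√(2 * Real.pi))⁻¹ * (√n)⁻¹ * (√(y + x) - √|y - x|) := fun x y => by
    rw [covK, ← add_div, ← sub_div, abs_div, abs_of_nonneg hn, Real.sqrt_div' _ hn,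
      Real.sqrt_div' _ hn]
    ring
  have e1 : |(p : ℝ) - q - 1| = |(q : ℝ) - p + 1| := by rw [← abs_neg]; ring_nf
  have e2 : |(p : ℝ) - q + 1| = |(q : ℝ) - p - 1| := by rw [← abs_neg]; ring_nf
  rw [scale, scale, scale, scale, absSqrtDiff, gam, e1, e2, abs_sub_comm (p : ℝ) q]
  push_cast
  ring_nf

end HeatGaussian

/-- Proposition 4.5 (variance limit): with `ΔF_j = F(j/n) − F((j−1)/n)` and
`σ_j² = E[ΔF_j²]`, for all `0 ≤ s < t`,
`E|∑_{j=⌊ns⌋+1}^{⌊nt⌋}(ΔF_j² − σ_j²)|² → κ²(t−s)` where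
`κ² = 4/π + (2/π)∑_{i=1}^∞ γ_i²`. -/
theorem centered_quadratic_variation_variance_limit {Ω : Type*} [MeasurableSpace Ω]
    (P : Measure Ω) (F : ℝ → Ω → ℝ) (hF : IsHeatGaussian P F)
    (s t : ℝ) (hs : 0 ≤ s) (hst : s < t) :
    Tendsto (fun n : ℕ => ∫ ω,
        (∑ j ∈ Finset.Icc (⌊(n : ℝ) * s⌋₊ + 1) ⌊(n : ℝ) * t⌋₊,
          ((F ((j : ℝ) / n) ω - F (((j : ℝ) - 1) / n) ω) ^ 2 -
            ∫ ω', (F ((j : ℝ) / n) ω' - F (((j : ℝ) - 1) / n) ω') ^ 2 ∂P)) ^ 2 ∂P)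
      atTop
      (nhds ((4 / Real.pi + 2 / Real.pi * ∑' i : ℕ, (gam (i + 1)) ^ 2) *
        (t - s))) := by
  set N : ℕ → ℕ := fun n => ⌊(n : ℝ) * t⌋₊ - ⌊(n : ℝ) * s⌋₊ with hN
  set E : ℕ → ℝ := fun n =>
    ∑ p ∈ Finset.range (N n), ∑ q ∈ Finset.range (N n),
      (absSqrtDiff ((p : ℝ) - q) - gam (2 * ⌊(n : ℝ) * s⌋₊ + p + q + 1)) ^ 2 with hE
  set A : ℕ → ℝ := fun M =>
    ∑ p ∈ Finset.range M, ∑ q ∈ Finset.range M, absSqrtDiff ((p : ℝ) - q) ^ 2 with hA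
  have ht : 0 ≤ t := hs.trans hst.le
  have hNdiv : Tendsto (fun n : ℕ => (N n : ℝ) / n) atTop (nhds (t - s)) := by
    have h1 := (tendsto_nat_floor_mul_div_atTop ht).comp tendsto_natCast_atTop_atTop
    have h2 := (tendsto_nat_floor_mul_div_atTop hs).comp tendsto_natCast_atTop_atTop
    refine (h1.sub h2).congr fun n => ?_
    have hle : ⌊(n : ℝ) * s⌋₊ ≤ ⌊(n : ℝ) * t⌋₊ :=
      Nat.floor_le_floor (mul_le_mul_of_nonneg_left hst.le n.cast_nonneg)
    simp only [hN, Function.comp_apply, mul_comm s, mul_comm t]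
    rw [Nat.cast_sub hle, sub_div]
  have hNtop : Tendsto N atTop atTop := by
    rw [← tendsto_natCast_atTop_iff (R := ℝ)]
    refine (hNdiv.pos_mul_atTop (sub_pos.2 hst) tendsto_natCast_atTop_atTop).congr' ?_
    filter_upwards [eventually_gt_atTop 0] with n hn
    exact div_mul_cancel₀ _ (by positivity)
  have hmain : Tendsto (fun n : ℕ => (n : ℝ)⁻¹ * A (N n)) atTop
      (nhds ((t - s) * (4 + 2 * ∑' i : ℕ, gam (i + 1) ^ 2))) := by
    refine (hNdiv.mul (tendsto_mean_absSqrtDiff_sq.comp hNtop)).congr' ?_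
    filter_upwards [hNtop.eventually_gt_atTop 0] with n hn
    have : (N n : ℝ) ≠ 0 := by positivity
    simp only [Function.comp_apply, hA]
    field_simp
  have herr : Tendsto (fun n : ℕ => (n : ℝ)⁻¹ * (E n - A (N n))) atTop (nhds 0) := by
    have hbound : Tendsto (fun n : ℕ => 5 * (√((N n : ℝ) / n) * (√(n : ℝ))⁻¹)) atTop (nhds 0) := by
      have h1 := (Real.continuous_sqrt.tendsto _).comp hNdiv
      have h2 : Tendsto (fun n : ℕ => (√(n : ℝ))⁻¹) atTop (nhds 0) :=
        (Real.tendsto_sqrt_atTop.comp tendsto_natCast_atTop_atTop).inv_tendsto_atTop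
      simpa using (h1.mul h2).const_mul 5
    refine squeeze_zero_norm (fun n => ?_) hbound
    have hn : (0 : ℝ) ≤ n := n.cast_nonneg
    rw [Real.norm_eq_abs, abs_mul, abs_of_nonneg (inv_nonneg.2 hn), Real.sqrt_div' _ hn]
    calc (n : ℝ)⁻¹ * |E n - A (N n)| ≤ (n : ℝ)⁻¹ * (5 * √(N n)) :=
          mul_le_mul_of_nonneg_left (abs_sum_sq_sub_sum_absSqrtDiff_sq_le _ _) (inv_nonneg.2 hn)
      _ = 5 * (√(N n) / √n * (√(n : ℝ))⁻¹) := by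
          rw [div_eq_mul_inv, mul_assoc, ← mul_inv, Real.mul_self_sqrt hn]
          ring
  have hlim := (hmain.add herr).const_mul Real.pi⁻¹
  have hval : Real.pi⁻¹ * ((t - s) * (4 + 2 * ∑' i : ℕ, gam (i + 1) ^ 2) + 0) =
      (4 / Real.pi + 2 / Real.pi * ∑' i : ℕ, (gam (i + 1)) ^ 2) * (t - s) := by ring
  rw [hval] at hlim
  refine hlim.congr fun n => ?_
  rw [hF.integral_sum_centered_sq_incr_sq _ (fun j : ℕ => (j : ℝ) / n)
    (fun j : ℕ => ((j : ℝ) - 1) / n) (fun j _ => by positivity) fun j hj => by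
      have : (1 : ℝ) ≤ j := by
        exact_mod_cast (Nat.le_add_left 1 _).trans (Finset.mem_Icc.1 hj).1
      exact div_nonneg (sub_nonneg.2 this) n.cast_nonneg]
  have hreindex : Finset.Icc (⌊(n : ℝ) * s⌋₊ + 1) ⌊(n : ℝ) * t⌋₊ =
      Finset.Ico (⌊(n : ℝ) * s⌋₊ + 1) (⌊(n : ℝ) * t⌋₊ + 1) := by
    ext
    simp
  have hcoef : ∀ x : ℝ, 2 * ((√(2 * Real.pi))⁻¹ * (√(n : ℝ))⁻¹ * x) ^ 2 =
      Real.pi⁻¹ * ((n : ℝ)⁻¹ * x ^ 2) := fun x => by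
    rw [mul_pow, mul_pow, inv_pow, inv_pow, Real.sq_sqrt (by positivity),
      Real.sq_sqrt n.cast_nonneg, mul_inv]
    ring
  rw [hreindex]
  simp only [Finset.sum_Ico_eq_sum_range, Nat.add_sub_add_right, covK_increments, hcoef]
  simp only [hE, hN, ← Finset.mul_sum]
  ring
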